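/- Let ε > 0, β, g ∈ ℝ, and let φ : ℝ → ℂ be continuously differentiable and compactly supported. Set u_ε(y) = (πε)^{-1/4} exp(−y²/(2ε)), f(y) = ∫_ℝ sgn(y−y′) u_ε(y′)² dy′, Φ(x,y) = φ(x) u_ε(y), T(x,y) = (−πβ f(y) |φ(x)|², 0), and V_ε(x,y) = x² + y²/ε² − 1/ε. Then ∫_{ℝ²} ( |(−i∇ + T) Φ|² + V_ε |Φ|² − (g/2) |Φ|⁴ ) dx dy = ∫_ℝ ( |φ'(x)|² + x² |φ(x)|² + (π²β²/3) |φ(x)|⁶ − (g̃/2) |φ(x)|⁴ ) dx, where g̃ = g ∫_ℝ u_ε⁴. That is, the 2D Chern-Simons-Schrödinger energy of the quasi-1D ansatz equals the 1D cubic-quintic NLS energy E^{1D}[φ]. -/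

import Mathlib

open MeasureTheory

/-- The Gaussian ground state `u_ε(y) = (πε)^{-1/4} exp(−y²/(2ε))`. -/
noncomputable def uGauss (ε y : ℝ) : ℝ :=
  (Real.pi * ε) ^ (-(1/4 : ℝ)) * Real.exp (-(y^2) / (2*ε))

/-- `f(y) = ∫ sgn(y−y′) u_ε(y′)² dy′`. -/
noncomputable def fSgn (ε y : ℝ) : ℝ :=
  ∫ y' : ℝ, Real.sign (y - y') * (uGauss ε y')^2

/-- The quasi-1D ansatz `Φ(x,y) = φ(x) u_ε(y)`. -/
noncomputable def PhiAnsatz (ε : ℝ) (φ : ℝ → ℂ) (p : ℝ × ℝ) : ℂ :=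
  φ p.1 * ((uGauss ε p.2 : ℝ) : ℂ)

lemma uG_sq (ε : ℝ) (hε : 0 < ε) (y : ℝ) :
    uGauss ε y ^ 2 = (Real.sqrt (Real.pi * ε))⁻¹ * Real.exp (-(1/ε) * y^2) := by
  have hp : 0 < Real.pi * ε := by positivity
  unfold uGauss
  rw [mul_pow, ← Real.rpow_natCast, ← Real.rpow_mul hp.le, ← Real.exp_nat_mul,
    Real.sqrt_eq_rpow, ← Real.rpow_neg hp.le]
  congr 1
  · norm_num
  · congr 1
    field_simp
    push_cast
    ring

lemma uG_int2 (ε : ℝ) (hε : 0 < ε) : Integrable (fun y => uGauss ε y ^ 2) := by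
  simp_rw [uG_sq ε hε]
  exact (integrable_exp_neg_mul_sq (by positivity)).const_mul _

lemma uG_norm (ε : ℝ) (hε : 0 < ε) : ∫ y, uGauss ε y ^ 2 = 1 := by
  simp_rw [uG_sq ε hε]
  rw [integral_const_mul, integral_gaussian]
  have : Real.pi / (1/ε) = Real.pi * ε := by field_simp
  rw [this]
  have hp : 0 < Real.sqrt (Real.pi * ε) := by positivity
  field_simp

lemma uG_cont (ε : ℝ) : Continuous (uGauss ε) := by
  unfold uGauss
  fun_prop

lemma uG_deriv (ε : ℝ) (hε : 0 < ε) (y : ℝ) :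
    HasDerivAt (uGauss ε) (-(y/ε) * uGauss ε y) y := by
  unfold uGauss
  have h1 : HasDerivAt (fun y : ℝ => -(y^2) / (2*ε)) (-(y/ε)) y := by
    have := ((hasDerivAt_pow 2 y).neg).div_const (2*ε)
    refine this.congr_deriv ?_
    push_cast
    field_simp
  have := (h1.exp).const_mul ((Real.pi * ε) ^ (-(1/4 : ℝ)))
  refine this.congr_deriv ?_
  ring

lemma uG_int4 (ε : ℝ) (hε : 0 < ε) : Integrable (fun y => uGauss ε y ^ 4) := by
  have h : ∀ y, uGauss ε y ^ 4 =
      (Real.sqrt (Real.pi * ε))⁻¹ ^ 2 * Real.exp (-(2/ε) * y^2) := by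
    intro y
    have : uGauss ε y ^ 4 = (uGauss ε y ^ 2) ^ 2 := by ring
    rw [this, uG_sq ε hε, mul_pow, ← Real.exp_nat_mul]
    congr 2
    push_cast
    ring
  simp_rw [h]
  exact (integrable_exp_neg_mul_sq (by positivity)).const_mul _

lemma uG_int_y (ε : ℝ) (hε : 0 < ε) : Integrable (fun y => y * uGauss ε y ^ 2) := by
  simp_rw [uG_sq ε hε]
  have := (integrable_mul_exp_neg_mul_sq (b := 1/ε) (by positivity)).const_mul
    (Real.sqrt (Real.pi * ε))⁻¹
  refine this.congr (Filter.Eventually.of_forall fun y => ?_)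
  simp only
  ring

lemma uG_int_yy (ε : ℝ) (hε : 0 < ε) :
    Integrable (fun y => (2 * y^2 / ε^2 - 1/ε) * uGauss ε y ^ 2) := by
  have h0 : Integrable (fun y => y^2 * uGauss ε y ^ 2) := by
    simp_rw [uG_sq ε hε]
    have := (integrable_rpow_mul_exp_neg_mul_sq (b := 1/ε) (by positivity)
      (s := 2) (by norm_num)).const_mul (Real.sqrt (Real.pi * ε))⁻¹
    refine this.congr (Filter.Eventually.of_forall fun y => ?_)
    simp only [Real.rpow_two]
    ring
  have := (h0.const_mul (2/ε^2)).sub ((uG_int2 ε hε).const_mul (1/ε))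
  refine this.congr (Filter.Eventually.of_forall fun y => ?_)
  simp only [Pi.sub_apply]
  ring

lemma uG_virial (ε : ℝ) (hε : 0 < ε) :
    ∫ y, (2 * y^2 / ε^2 - 1/ε) * uGauss ε y ^ 2 = 0 := by
  refine integral_eq_zero_of_hasDerivAt_of_integrable
    (f := fun y => -(1/ε) * (y * uGauss ε y ^ 2)) ?_ (uG_int_yy ε hε)
    ((uG_int_y ε hε).const_mul _)
  intro y
  have := (((hasDerivAt_id y).mul ((uG_deriv ε hε y).pow 2)).const_mul (-(1/ε)))
  refine this.congr_deriv ?_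
  simp
  field_simp
  ring

lemma fS_eq (ε : ℝ) (hε : 0 < ε) (y : ℝ) :
    fSgn ε y = (∫ t in Set.Iic 0, uGauss ε t ^ 2) - (∫ t in Set.Ioi 0, uGauss ε t ^ 2)
      + 2 * ∫ t in (0:ℝ)..y, uGauss ε t ^ 2 := by
  have hi := uG_int2 ε hε
  have h1 := intervalIntegral.integral_Iic_sub_Iic (a := 0) (b := y)
    hi.integrableOn hi.integrableOn
  have h2 := intervalIntegral.integral_Ioi_sub_Ioi' (a := 0) (b := y)
    hi.integrableOn hi.integrableOn
  have hm : Measurable (fun y' => Real.sign (y - y')) := by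
    have : Measurable Real.sign := by
      unfold Real.sign
      exact Measurable.ite measurableSet_Iio measurable_const
        (Measurable.ite measurableSet_Ioi measurable_const measurable_const)
    exact this.comp (by fun_prop)
  have hs : Integrable (fun y' => Real.sign (y - y') * uGauss ε y' ^ 2) := by
    refine hi.bdd_mul (c := 1) hm.aestronglyMeasurable (Filter.Eventually.of_forall fun t => ?_)
    rcases Real.sign_apply_eq (y - t) with h | h | h <;> rw [h] <;> norm_num
  have h3 := intervalIntegral.integral_Iic_add_Ioi (b := y) hs.integrableOn hs.integrableOn
  have h4 : ∫ t in Set.Iic y, Real.sign (y - t) * uGauss ε t ^ 2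
      = ∫ t in Set.Iic y, uGauss ε t ^ 2 := by
    rw [integral_Iic_eq_integral_Iio, integral_Iic_eq_integral_Iio]
    refine setIntegral_congr_fun measurableSet_Iio fun t ht => ?_
    beta_reduce
    rw [Real.sign_of_pos (sub_pos.2 ht), one_mul]
  have h5 : ∫ t in Set.Ioi y, Real.sign (y - t) * uGauss ε t ^ 2
      = - ∫ t in Set.Ioi y, uGauss ε t ^ 2 := by
    rw [← integral_neg]
    refine setIntegral_congr_fun measurableSet_Ioi fun t ht => ?_
    beta_reduce
    rw [Real.sign_of_neg (sub_neg.2 ht), neg_one_mul]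
  unfold fSgn
  linarith

lemma fS_bound (ε : ℝ) (hε : 0 < ε) (y : ℝ) : ‖fSgn ε y‖ ≤ 1 := by
  rw [← uG_norm ε hε]
  refine norm_integral_le_of_norm_le (uG_int2 ε hε) (Filter.Eventually.of_forall fun t => ?_)
  rw [norm_mul, norm_pow, Real.norm_eq_abs (uGauss ε t), sq_abs]
  refine mul_le_of_le_one_left (sq_nonneg _) ?_
  rcases Real.sign_apply_eq (y - t) with h | h | h <;> rw [h] <;> norm_num

lemma fS_deriv (ε : ℝ) (hε : 0 < ε) (y : ℝ) :
    HasDerivAt (fSgn ε) (2 * uGauss ε y ^ 2) y := by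
  have hc : Continuous (fun t => uGauss ε t ^ 2) := (uG_cont ε).pow 2
  have : fSgn ε = fun y => (∫ t in Set.Iic 0, uGauss ε t ^ 2)
      - (∫ t in Set.Ioi 0, uGauss ε t ^ 2) + 2 * ∫ t in (0:ℝ)..y, uGauss ε t ^ 2 :=
    funext (fS_eq ε hε)
  rw [this]
  exact ((hc.integral_hasStrictDerivAt 0 y).hasDerivAt.const_mul 2).const_add _

lemma fS_cont (ε : ℝ) (hε : 0 < ε) : Continuous (fSgn ε) :=
  continuous_iff_continuousAt.2 fun y => (fS_deriv ε hε y).continuousAt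

lemma fS_top (ε : ℝ) (hε : 0 < ε) : Filter.Tendsto (fSgn ε) Filter.atTop (nhds 1) := by
  have hi := uG_int2 ε hε
  have h := intervalIntegral_tendsto_integral_Ioi (f := fun t => uGauss ε t ^ 2) (μ := volume)
    0 hi.integrableOn Filter.tendsto_id
  have h3 := intervalIntegral.integral_Iic_add_Ioi (b := 0) hi.integrableOn hi.integrableOn
  rw [uG_norm ε hε] at h3
  have := (h.const_mul 2).const_add ((∫ t in Set.Iic 0, uGauss ε t ^ 2)
      - (∫ t in Set.Ioi 0, uGauss ε t ^ 2))
  convert this using 1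
  · exact funext (fS_eq ε hε)
  · congr 1
    linarith

lemma fS_bot (ε : ℝ) (hε : 0 < ε) : Filter.Tendsto (fSgn ε) Filter.atBot (nhds (-1)) := by
  have hi := uG_int2 ε hε
  have h := intervalIntegral_tendsto_integral_Iic (f := fun t => uGauss ε t ^ 2) (μ := volume)
    0 hi.integrableOn Filter.tendsto_id
  have h3 := intervalIntegral.integral_Iic_add_Ioi (b := 0) hi.integrableOn hi.integrableOn
  rw [uG_norm ε hε] at h3
  have := (h.const_mul (-2)).const_add ((∫ t in Set.Iic 0, uGauss ε t ^ 2)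
      - (∫ t in Set.Ioi 0, uGauss ε t ^ 2))
  convert this using 1
  · funext y
    rw [fS_eq ε hε, intervalIntegral.integral_symm]
    simp
  · congr 1
    linarith

lemma fS_int1 (ε : ℝ) (hε : 0 < ε) : Integrable (fun y => fSgn ε y * uGauss ε y ^ 2) :=
  (uG_int2 ε hε).bdd_mul (c := 1) (fS_cont ε hε).aestronglyMeasurable
    (Filter.Eventually.of_forall (fS_bound ε hε))

lemma fS_int2 (ε : ℝ) (hε : 0 < ε) : Integrable (fun y => fSgn ε y ^ 2 * uGauss ε y ^ 2) := by
  have := (fS_int1 ε hε).bdd_mul (c := 1) (fS_cont ε hε).aestronglyMeasurable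
    (Filter.Eventually.of_forall (fS_bound ε hε))
  refine this.congr (Filter.Eventually.of_forall fun y => ?_)
  simp only
  ring

lemma fS_mean (ε : ℝ) (hε : 0 < ε) : ∫ y, fSgn ε y * uGauss ε y ^ 2 = 0 := by
  have := integral_of_hasDerivAt_of_tendsto (f := fun y => (1/4) * fSgn ε y ^ 2)
    (f' := fun y => fSgn ε y * uGauss ε y ^ 2) (fun y => ?_) (fS_int1 ε hε)
    (((fS_bot ε hε).pow 2).const_mul _) (((fS_top ε hε).pow 2).const_mul _)
  · rw [this]; norm_num
  · have := ((fS_deriv ε hε y).pow 2).const_mul (1/4)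
    refine this.congr_deriv ?_
    push_cast
    ring

lemma fS_sq (ε : ℝ) (hε : 0 < ε) : ∫ y, fSgn ε y ^ 2 * uGauss ε y ^ 2 = 1/3 := by
  have := integral_of_hasDerivAt_of_tendsto (f := fun y => (1/6) * fSgn ε y ^ 3)
    (f' := fun y => fSgn ε y ^ 2 * uGauss ε y ^ 2) (fun y => ?_) (fS_int2 ε hε)
    (((fS_bot ε hε).pow 3).const_mul _) (((fS_top ε hε).pow 3).const_mul _)
  · rw [this]; norm_num
  · have := ((fS_deriv ε hε y).pow 3).const_mul (1/6)
    refine this.congr_deriv ?_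
    push_cast
    ring

lemma Phi_fderiv (ε : ℝ) (hε : 0 < ε) (φ : ℝ → ℂ) (hφ : ContDiff ℝ 1 φ) (p : ℝ × ℝ) :
    fderiv ℝ (PhiAnsatz ε φ) p (1, 0) = deriv φ p.1 * (uGauss ε p.2 : ℂ) ∧
    fderiv ℝ (PhiAnsatz ε φ) p (0, 1) = φ p.1 * ((-(p.2/ε) * uGauss ε p.2 : ℝ) : ℂ) := by
  have h1 : HasDerivAt φ (deriv φ p.1) p.1 :=
    (hφ.differentiable (by norm_num) p.1).hasDerivAt
  have h2 := (uG_deriv ε hε p.2).ofReal_comp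
  have h3 := (h1.hasFDerivAt.comp p hasFDerivAt_fst).mul (h2.hasFDerivAt.comp p hasFDerivAt_snd)
  have h4 : HasFDerivAt (PhiAnsatz ε φ) _ p := h3
  rw [h4.fderiv]
  constructor <;> simp <;> ring

lemma pointwise_id (a d : ℂ) (u t : ℝ) :
    ‖-Complex.I * (d * (u : ℂ)) + (t : ℂ) * (a * (u : ℂ))‖^2
      = (‖d‖^2 + 2 * t * (d.im * a.re - d.re * a.im) + t^2 * ‖a‖^2) * u^2 := by
  simp only [Complex.sq_norm, Complex.normSq_apply]
  simp
  ring

/-- Dimensional reduction of the energy: the 2D Chern-Simons-Schrödinger energy of the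
quasi-1D ansatz `Φ = φ(x)u_ε(y)` in the gauge `T = (−πβ f(y)|φ(x)|², 0)`, with trap
`V_ε = x² + y²/ε² − 1/ε`, equals the 1D cubic-quintic NLS energy
`∫ (|φ'|² + x²|φ|² + (π²β²/3)|φ|⁶ − (g̃/2)|φ|⁴)` with `g̃ = g ∫ u_ε⁴`. -/
theorem energy_dimensional_reduction (ε β g : ℝ) (hε : 0 < ε)
    (φ : ℝ → ℂ) (hφ : ContDiff ℝ 1 φ) (hsupp : HasCompactSupport φ) :
    (∫ p : ℝ × ℝ,
        (‖-Complex.I * fderiv ℝ (PhiAnsatz ε φ) p (1, 0)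
            + ((-Real.pi * β * fSgn ε p.2 * ‖φ p.1‖^2 : ℝ) : ℂ) * PhiAnsatz ε φ p‖^2
          + ‖-Complex.I * fderiv ℝ (PhiAnsatz ε φ) p (0, 1)‖^2
          + (p.1^2 + p.2^2 / ε^2 - 1/ε) * ‖PhiAnsatz ε φ p‖^2
          - g/2 * ‖PhiAnsatz ε φ p‖^4))
      = ∫ x : ℝ,
          (‖deriv φ x‖^2 + x^2 * ‖φ x‖^2
            + (Real.pi^2 * β^2 / 3) * ‖φ x‖^6
            - (g * ∫ y : ℝ, (uGauss ε y)^4) / 2 * ‖φ x‖^4) := by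
  have hφc : Continuous φ := hφ.continuous
  have hdc : Continuous (deriv φ) := hφ.continuous_deriv (by norm_num)
  have hds : HasCompactSupport (deriv φ) := hsupp.deriv
  have key : ∀ F : ℝ → ℝ, Continuous F → (∀ x, φ x = 0 → deriv φ x = 0 → F x = 0) →
      Integrable F := by
    intro F hF h0
    refine hF.integrable_of_hasCompactSupport ?_
    refine HasCompactSupport.intro (hsupp.isCompact.union hds.isCompact) fun x hx => ?_
    simp only [Set.mem_union, not_or] at hx
    exact h0 x (image_eq_zero_of_notMem_tsupport hx.1) (image_eq_zero_of_notMem_tsupport hx.2)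
  have i1 : Integrable (fun x => ‖deriv φ x‖^2 + x^2 * ‖φ x‖^2) :=
    key _ (by fun_prop) (by intro x h h'; simp [h, h'])
  have i2 : Integrable (fun x => -2 * Real.pi * β * ‖φ x‖^2 *
      ((deriv φ x).im * (φ x).re - (deriv φ x).re * (φ x).im)) :=
    key _ (by fun_prop) (by intro x h h'; simp [h, h'])
  have i3 : Integrable (fun x => Real.pi^2 * β^2 * ‖φ x‖^6) :=
    key _ (by fun_prop) (by intro x h h'; simp [h])
  have i4 : Integrable (fun x => ‖φ x‖^2) :=
    key _ (by fun_prop) (by intro x h h'; simp [h])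
  have i5 : Integrable (fun x => g/2 * ‖φ x‖^4) :=
    key _ (by fun_prop) (by intro x h h'; simp [h])
  have j1 := i1.mul_prod (uG_int2 ε hε)
  have j2 := i2.mul_prod (fS_int1 ε hε)
  have j3 := i3.mul_prod (fS_int2 ε hε)
  have j4 := i4.mul_prod (uG_int_yy ε hε)
  have j5 := i5.mul_prod (uG_int4 ε hε)
  have e1 := integral_prod_mul (μ := (volume : Measure ℝ)) (ν := (volume : Measure ℝ))
    (fun x => ‖deriv φ x‖^2 + x^2 * ‖φ x‖^2) (fun y => uGauss ε y ^ 2)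
  have e2 := integral_prod_mul (μ := (volume : Measure ℝ)) (ν := (volume : Measure ℝ))
    (fun x => -2 * Real.pi * β * ‖φ x‖^2 *
      ((deriv φ x).im * (φ x).re - (deriv φ x).re * (φ x).im))
    (fun y => fSgn ε y * uGauss ε y ^ 2)
  have e3 := integral_prod_mul (μ := (volume : Measure ℝ)) (ν := (volume : Measure ℝ))
    (fun x => Real.pi^2 * β^2 * ‖φ x‖^6) (fun y => fSgn ε y ^ 2 * uGauss ε y ^ 2)
  have e4 := integral_prod_mul (μ := (volume : Measure ℝ)) (ν := (volume : Measure ℝ))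
    (fun x => ‖φ x‖^2) (fun y => (2 * y^2 / ε^2 - 1/ε) * uGauss ε y ^ 2)
  have e5 := integral_prod_mul (μ := (volume : Measure ℝ)) (ν := (volume : Measure ℝ))
    (fun x => g/2 * ‖φ x‖^4) (fun y => uGauss ε y ^ 4)
  rw [uG_norm ε hε] at e1
  rw [fS_mean ε hε] at e2
  rw [fS_sq ε hε] at e3
  rw [uG_virial ε hε] at e4
  have hL := integral_sub (((j1.add j2).add j3).add j4) j5
  rw [integral_add' ((j1.add j2).add j3) j4, integral_add' (j1.add j2) j3,
    integral_add' j1 j2, e1, e2, e3, e4, e5] at hL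
  have hR := integral_sub (i1.add (i3.mul_const (1/3)))
    (i5.mul_const (∫ y : ℝ, (uGauss ε y)^4))
  rw [integral_add' i1 (i3.mul_const (1/3)), integral_mul_const, integral_mul_const] at hR
  have hLR := hL.trans ((by ring : _ = _).trans hR.symm)
  refine Eq.trans ?_ (hLR.trans ?_)
  · rw [Measure.volume_eq_prod]
    refine integral_congr_ae (Filter.Eventually.of_forall fun p => ?_)
    simp only [Pi.add_apply]
    obtain ⟨h1, h2⟩ := Phi_fderiv ε hε φ hφ p
    rw [h1, h2]
    simp only [PhiAnsatz]
    rw [pointwise_id]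
    simp only [norm_mul, norm_neg, Complex.norm_I, Complex.norm_real, one_mul, mul_pow,
      Real.norm_eq_abs, sq_abs, abs_mul, abs_neg, (by decide : Even 4).pow_abs]
    ring
  · refine integral_congr_ae (Filter.Eventually.of_forall fun x => ?_)
    simp only [Pi.add_apply]
    ring
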